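/- Let φ : R → S be a homomorphism of commutative rings. Then the following five conditions are equivalent: (1) the multiplication map μ : S ⊗_R S → S, s ⊗ t ↦ st, is bijective and Tor_i^R(S, S) = 0 for all i ≥ 1; (2) for every S-module M the action map α_M : S ⊗_R M → M, s ⊗ m ↦ s • m, is bijective and Tor_i^R(S, M) = 0 for all i ≥ 1; (3) for every S-module M the canonical map η_M : M → Hom_R(S, M), m ↦ (s ↦ s • m), is bijective and Ext^i_R(S, M) = 0 for all i ≥ 1; (4) for all S-modules M, M' and all i ≥ 0, the natural map Ext^i_S(M, M') → Ext^i_R(M, M') induced by restriction of scalars is an isomorphism; (5) the functor D(φ) : D(S) → D(R) between unbounded derived categories induced by restriction of scalars is fully faithful. -/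

import Mathlib

/-!
Homological epimorphisms of rings (Geigle–Lenzing).
`φ : R →+* S`; every `S`-module is an `R`-module by restriction of scalars.
-/

universe w u

open CategoryTheory Limits DerivedCategory

noncomputable section

namespace RingHomEpi

variable {R S : Type u} [CommRing R] [CommRing S] (φ : R →+* S)

instance : (ModuleCat.restrictScalars.{u} φ).Additive where
  map_add := rfl

/-- `S` regarded as an `R`-module via `φ`. -/
abbrev SasR : ModuleCat.{u} R := (ModuleCat.restrictScalars φ).obj (ModuleCat.of S S)

/-- The canonical map `η_M : M → Hom_R(S, M)`, `m ↦ (s ↦ s • m)`. -/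
def etaMap (M : ModuleCat.{u} S) :
    M → (SasR φ →ₗ[R] (ModuleCat.restrictScalars φ).obj M) := fun m =>
  { toFun := fun s => (show S from s) • (show M from m)
    map_add' := fun s t => add_smul (show S from s) (show S from t) (show M from m)
    map_smul' := fun r s => by
      show (φ r • (show S from s)) • (show M from m) =
        φ r • ((show S from s) • (show M from m))
      exact smul_assoc (φ r) (show S from s) (show M from m) }

/-- The action of `S` on an `S`-module `M`, as an `R`-bilinear map. -/
def actionBilin (M : ModuleCat.{u} S) :
    SasR φ →ₗ[R]
      ((ModuleCat.restrictScalars φ).obj M →ₗ[R] (ModuleCat.restrictScalars φ).obj M) where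
  toFun s :=
    { toFun := fun m => (show S from s) • (show M from m)
      map_add' := fun m m' => smul_add (show S from s) (show M from m) (show M from m')
      map_smul' := fun r m => by
        show (show S from s) • (φ r • (show M from m)) =
          φ r • ((show S from s) • (show M from m))
        rw [smul_comm] }
  map_add' s t := LinearMap.ext fun m => add_smul (show S from s) (show S from t) (show M from m)
  map_smul' r s := LinearMap.ext fun m => by
    show (φ r • (show S from s)) • (show M from m) =
      φ r • ((show S from s) • (show M from m))
    exact smul_assoc (φ r) (show S from s) (show M from m)

/-- The action map `α_M : S ⊗_R M → M`, `s ⊗ m ↦ s • m`. -/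
def actionMap (M : ModuleCat.{u} S) :
    TensorProduct R (SasR φ) ((ModuleCat.restrictScalars φ).obj M) →ₗ[R]
      (ModuleCat.restrictScalars φ).obj M :=
  TensorProduct.lift (actionBilin φ M)

/-- The multiplication map `μ : S ⊗_R S → S`, `s ⊗ t ↦ s * t`. -/
def mulMap : TensorProduct R (SasR φ) (SasR φ) →ₗ[R] SasR φ :=
  actionMap φ (ModuleCat.of S S)

/-- Restriction of scalars is compatible with the forgetful functors to abelian groups. -/
def restrictScalarsCompForget₂Iso :
    ModuleCat.restrictScalars.{u} φ ⋙ forget₂ (ModuleCat.{u} R) AddCommGrpCat ≅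
      forget₂ (ModuleCat.{u} S) AddCommGrpCat :=
  NatIso.ofComponents (fun _ => Iso.refl _) (fun _ => rfl)

instance : PreservesFiniteLimits (ModuleCat.restrictScalars.{u} φ) := by
  have : PreservesFiniteLimits
      (ModuleCat.restrictScalars.{u} φ ⋙ forget₂ (ModuleCat.{u} R) AddCommGrpCat) :=
    preservesFiniteLimits_of_natIso (restrictScalarsCompForget₂Iso φ).symm
  exact preservesFiniteLimits_of_reflects_of_preserves _
    (forget₂ (ModuleCat.{u} R) AddCommGrpCat)

instance : PreservesFiniteColimits (ModuleCat.restrictScalars.{u} φ) := by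
  have : PreservesFiniteColimits
      (ModuleCat.restrictScalars.{u} φ ⋙ forget₂ (ModuleCat.{u} R) AddCommGrpCat) :=
    preservesFiniteColimits_of_natIso (restrictScalarsCompForget₂Iso φ).symm
  exact preservesFiniteColimits_of_reflects_of_preserves _
    (forget₂ (ModuleCat.{u} R) AddCommGrpCat)

attribute [local instance] CategoryTheory.hasExt_of_hasDerivedCategory

variable [HasDerivedCategory.{w} (ModuleCat.{u} R)]
  [HasDerivedCategory.{w} (ModuleCat.{u} S)]

/-- The functor `D(φ) : D(S) → D(R)` induced by restriction of scalars along `φ`. -/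
abbrev Dphi : DerivedCategory (ModuleCat.{u} S) ⥤ DerivedCategory (ModuleCat.{u} R) :=
  (ModuleCat.restrictScalars.{u} φ).mapDerivedCategory

/-- `D(φ)` commutes with the single complex functors. -/
def singleObjIso (M : ModuleCat.{u} S) :
    (Dphi φ).obj ((DerivedCategory.singleFunctor (ModuleCat.{u} S) 0).obj M) ≅
      (DerivedCategory.singleFunctor (ModuleCat.{u} R) 0).obj
        ((ModuleCat.restrictScalars φ).obj M) :=
  (Dphi φ).mapIso
    (((SingleFunctors.evaluation _ _ 0).mapIso
      (DerivedCategory.singleFunctorsPostcompQIso (ModuleCat.{u} S))).app M)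
  ≪≫ ((ModuleCat.restrictScalars.{u} φ).mapDerivedCategoryFactors.app _)
  ≪≫ DerivedCategory.Q.mapIso
      ((HomologicalComplex.singleMapHomologicalComplex
        (ModuleCat.restrictScalars.{u} φ) (ComplexShape.up ℤ) 0).app M)
  ≪≫ (((SingleFunctors.evaluation _ _ 0).mapIso
      (DerivedCategory.singleFunctorsPostcompQIso (ModuleCat.{u} R))).symm.app _)

/-- The natural comparison map `Ext^n_S(M, M') → Ext^n_R(M, M')` induced by
restriction of scalars along `φ`. -/
def extMap {M M' : ModuleCat.{u} S} {n : ℕ} (e : Abelian.Ext.{w} M M' n) :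
    Abelian.Ext.{w} ((ModuleCat.restrictScalars φ).obj M)
      ((ModuleCat.restrictScalars φ).obj M') n :=
  Abelian.Ext.homEquiv.symm
    ((singleObjIso φ M).inv ≫ (Dphi φ).map e.hom ≫
      ((Dphi φ).commShiftIso (n : ℤ)).hom.app _ ≫
      (shiftFunctor (DerivedCategory (ModuleCat.{u} R)) (n : ℤ)).map
        (singleObjIso φ M').hom)

end RingHomEpi

namespace RingHomEpi

variable {R S : Type u} [CommRing R] [CommRing S] (φ : R →+* S)

/-- Elementwise criterion for exactness of a complex of modules. -/
lemma exactAt_iff_elem {ι : Type*} {c : ComplexShape ι} (K : HomologicalComplex (ModuleCat.{u} R) c)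
    (i j k : ι) (hi : c.prev j = i) (hk : c.next j = k) :
    K.ExactAt j ↔ ∀ x : K.X j, (K.d j k).hom x = 0 → ∃ y : K.X i, (K.d i j).hom y = x := by
  rw [K.exactAt_iff' i j k hi hk, ShortComplex.moduleCat_exact_iff]
  rfl

open MonoidalCategory in
lemma isZero_Tor_of_ext [HasExt.{w} (ModuleCat.{u} R)] (A M : ModuleCat.{u} R) (n : ℕ)
    (h : Subsingleton (Abelian.Ext.{w} M (ModuleCat.of R (CharacterModule A)) (n + 1))) :
    IsZero (((Tor (ModuleCat.{u} R) (n + 1)).obj A).obj M) := by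
  let P := projectiveResolution M
  refine IsZero.of_iso ?_ (P.isoLeftDerivedObj ((tensoringLeft _).obj A) (n + 1))
  change IsZero (HomologicalComplex.homology _ _)
  rw [← HomologicalComplex.exactAt_iff_isZero_homology,
    exactAt_iff_elem _ (n + 2) (n + 1) n (by simp) (by simp)]
  intro x hx
  have hd : ∀ (i j : ℕ), ((((tensoringLeft (ModuleCat.{u} R)).obj A).mapHomologicalComplex
      (ComplexShape.down ℕ)).obj P.complex).d i j = A ◁ P.complex.d i j := fun i j => rfl
  let D : TensorProduct R A (P.complex.X (n + 2)) →ₗ[R] TensorProduct R A (P.complex.X (n + 1)) :=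
    LinearMap.lTensor A (P.complex.d (n + 2) (n + 1)).hom
  let D' : TensorProduct R A (P.complex.X (n + 1)) →ₗ[R] TensorProduct R A (P.complex.X n) :=
    LinearMap.lTensor A (P.complex.d (n + 1) n).hom
  change TensorProduct R A (P.complex.X (n + 1)) at x
  change D' x = 0 at hx
  change x ∈ LinearMap.range D
  rw [← Submodule.Quotient.mk_eq_zero]
  apply CharacterModule.eq_zero_of_character_apply
  intro c
  let c' : CharacterModule (TensorProduct R (P.complex.X (n + 1)) A) :=
    CharacterModule.dual (((LinearMap.range D).mkQ).comp (TensorProduct.comm R _ _).toLinearMap) c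
  let f : P.complex.X (n + 1) →ₗ[R] CharacterModule A := CharacterModule.curry c'
  have hf : P.complex.d (n + 2) (n + 1) ≫ ModuleCat.ofHom f = 0 := by
    ext p
    rename_i a
    change c (Submodule.Quotient.mk (D (a ⊗ₜ p))) = 0
    rw [(Submodule.Quotient.mk_eq_zero _).2 (LinearMap.mem_range_self D _), map_zero]
  obtain ⟨g, hg⟩ := (P.extMk_eq_zero_iff (ModuleCat.ofHom f) (n + 2) rfl hf n rfl).1
    (Subsingleton.elim _ _)
  have key : ∀ y : TensorProduct R A (P.complex.X (n + 1)),
      c (Submodule.Quotient.mk y) = CharacterModule.uncurry g.hom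
        (TensorProduct.comm R _ _ (D' y)) := by
    intro y
    induction y using TensorProduct.induction_on with
    | zero => rw [map_zero, map_zero, map_zero]; exact map_zero c
    | add a b ha hb => rw [Submodule.Quotient.mk_add, map_add, ha, hb, map_add, map_add, map_add]
    | tmul a p =>
      have := congrArg (fun t => t a) (congrArg (fun t => t.hom p) hg)
      exact this.symm
  rw [key, hx, map_zero, map_zero]

/-- `s ⊗ 1 = 1 ⊗ s`. -/
def IsEpi : Prop := ∀ s : S, (TensorProduct.tmul R (show SasR φ from s) (show SasR φ from (1 : S))) =
  TensorProduct.tmul R (show SasR φ from (1 : S)) (show SasR φ from s)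

lemma isEpi_of_mul (h : Function.Injective (mulMap φ)) : IsEpi φ := by
  intro s
  apply h
  change s * 1 = 1 * s
  ring

lemma eta_bijective (h : IsEpi φ) (M : ModuleCat.{u} S) : Function.Bijective (etaMap φ M) := by
  constructor
  · intro m m' hm
    have := LinearMap.congr_fun hm (show SasR φ from (1 : S))
    change (1 : S) • (show M from m) = (1 : S) • (show M from m') at this
    simpa using this
  · intro f
    refine ⟨f (show SasR φ from (1 : S)), ?_⟩
    ext s
    let T : TensorProduct R (SasR φ) (SasR φ) →ₗ[R] (ModuleCat.restrictScalars φ).obj M :=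
      (actionMap φ M).comp (LinearMap.lTensor _ f)
    have := congrArg T (h s)
    change (show S from s) • (show M from f (show SasR φ from (1 : S))) =
      (1 : S) • (show M from f s) at this
    rw [one_smul] at this
    exact this

lemma action_bijective (h : IsEpi φ) (M : ModuleCat.{u} S) :
    Function.Bijective (actionMap φ M) := by
  have key : ∀ x : TensorProduct R (SasR φ) ((ModuleCat.restrictScalars φ).obj M),
      TensorProduct.tmul R (show SasR φ from (1 : S)) (actionMap φ M x) = x := by
    intro x
    induction x using TensorProduct.induction_on with
    | zero => rw [map_zero, TensorProduct.tmul_zero]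
    | add a b ha hb => rw [map_add, TensorProduct.tmul_add, ha, hb]
    | tmul s m =>
      let T : TensorProduct R (SasR φ) (SasR φ) →ₗ[R]
          TensorProduct R (SasR φ) ((ModuleCat.restrictScalars φ).obj M) :=
        LinearMap.lTensor _ (etaMap φ M m)
      have := congrArg T (h s)
      have e : etaMap φ M m (show SasR φ from (1 : S)) = m := one_smul S (show M from m)
      refine Eq.trans this.symm ?_
      change TensorProduct.tmul R s (etaMap φ M m (show SasR φ from (1 : S))) = _
      rw [e]
  constructor
  · intro x y hxy
    rw [← key x, ← key y, hxy]
  · intro m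
    refine ⟨TensorProduct.tmul R (show SasR φ from (1 : S)) m, ?_⟩
    exact one_smul S (show M from m)

lemma isEpi_of_eta (h : ∀ M : ModuleCat.{u} S, Function.Surjective (etaMap φ M)) : IsEpi φ := by
  algebraize [φ]
  intro s
  let M : ModuleCat.{u} S := ModuleCat.of S (TensorProduct R S S)
  let f : SasR φ →ₗ[R] (ModuleCat.restrictScalars φ).obj M :=
    { toFun := fun t => ((1 : S) ⊗ₜ[R] (show S from t) : TensorProduct R S S)
      map_add' := fun a b => TensorProduct.tmul_add _ _ _
      map_smul' := fun r a => by
        change (1 : S) ⊗ₜ[R] (φ r * (show S from a)) =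
          (φ r) • ((1 : S) ⊗ₜ[R] (show S from a) : TensorProduct R S S)
        rw [TensorProduct.smul_tmul']
        have h1 : (φ r) • (1 : S) = r • (1 : S) := by
          rw [Algebra.smul_def]; rfl
        rw [h1, TensorProduct.smul_tmul, Algebra.smul_def]
        rfl }
  obtain ⟨m, hm⟩ := h M f
  have e1 := LinearMap.congr_fun hm (show SasR φ from (1 : S))
  have es := LinearMap.congr_fun hm (show SasR φ from s)
  change (1 : S) • (show TensorProduct R S S from m) = (1 : S) ⊗ₜ[R] (1 : S) at e1
  change s • (show TensorProduct R S S from m) = (1 : S) ⊗ₜ[R] s at es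
  rw [one_smul] at e1
  rw [e1, TensorProduct.smul_tmul', smul_eq_mul, mul_one] at es
  let g : S →ₗ[R] SasR φ :=
    { toFun := fun t => t
      map_add' := fun _ _ => rfl
      map_smul' := fun r a => by
        change r • a = φ r * a
        rw [Algebra.smul_def]; rfl }
  exact congrArg (TensorProduct.map g g) es

/-- The map `S ⟶ X` determined by an element. -/
def spanHom (X : ModuleCat.{u} S) (x : X) : ModuleCat.of S S ⟶ X :=
  ModuleCat.ofHom (LinearMap.toSpanSingleton S X x)

lemma lift_of_exact {X Z Y W : ModuleCat.{u} S} [Projective X] (f : X ⟶ Y) (g : Z ⟶ Y) (h : Y ⟶ W)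
    (hex : ∀ y : Y, h.hom y = 0 → ∃ z : Z, g.hom z = y) (hf : f ≫ h = 0) :
    ∃ l : X ⟶ Z, l ≫ g = f := by
  have : Epi (ModuleCat.ofHom (g.hom.rangeRestrict)) := by
    rw [ModuleCat.epi_iff_surjective]
    exact g.hom.surjective_rangeRestrict
  let f' : X ⟶ ModuleCat.of S (LinearMap.range g.hom) := ModuleCat.ofHom
    (f.hom.codRestrict _ (fun x => by
      obtain ⟨z, hz⟩ := hex (f.hom x) (congrArg (fun t => t.hom x) hf)
      exact ⟨z, hz⟩))
  refine ⟨Projective.factorThru f' (ModuleCat.ofHom (g.hom.rangeRestrict)), ?_⟩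
  have := Projective.factorThru_comp f' (ModuleCat.ofHom (g.hom.rangeRestrict))
  ext x
  have h2 := congrArg (fun t => (t.hom x).1) this
  exact h2

open MonoidalCategory in
lemma ext_vanish_of_tor [HasExt.{w} (ModuleCat.{u} R)]
    (hmul : Function.Injective (mulMap φ))
    (htor : ∀ i : ℕ, 1 ≤ i → IsZero (((Tor (ModuleCat.{u} R) i).obj (SasR φ)).obj (SasR φ)))
    (M : ModuleCat.{u} S) (n : ℕ) :
    Subsingleton (Abelian.Ext.{w} (SasR φ) ((ModuleCat.restrictScalars φ).obj M) (n + 1)) := by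
  let P := projectiveResolution (SasR φ)
  let E := ModuleCat.extendScalars.{u, u, u} φ
  let adj := ModuleCat.extendRestrictScalarsAdj.{u} φ
  have hproj : ∀ i, Projective (E.obj (P.complex.X i)) := fun i =>
    adj.map_projective _ inferInstance
  let d : ∀ i : ℕ, E.obj (P.complex.X (i + 1)) ⟶ E.obj (P.complex.X i) := fun i =>
    E.map (P.complex.d (i + 1) i)
  have hdd : ∀ i, d (i + 1) ≫ d i = 0 := fun i => by
    change E.map _ ≫ E.map _ = 0
    rw [← E.map_comp, HomologicalComplex.d_comp_d]
    have : E.Additive := adj.left_adjoint_additive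
    exact E.map_zero _ _
  have hex : ∀ i (y : E.obj (P.complex.X (i + 1))), (d i).hom y = 0 → ∃ z, (d (i + 1)).hom z = y := by
    intro i
    have h1 := IsZero.of_iso (htor (i + 1) (by omega))
      (P.isoLeftDerivedObj ((tensoringLeft _).obj (SasR φ)) (i + 1)).symm
    change IsZero (HomologicalComplex.homology _ _) at h1
    rw [← HomologicalComplex.exactAt_iff_isZero_homology,
      exactAt_iff_elem _ (i + 2) (i + 1) i (by simp) (by simp)] at h1
    exact h1
  let ε : E.obj (P.complex.X 0) ⟶ ModuleCat.of S S := (adj.homEquiv _ _).symm (P.π.f 0)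
  have hε : ∀ y : TensorProduct R (SasR φ) (P.complex.X 0), ε.hom y =
      mulMap φ (LinearMap.lTensor (SasR φ) (P.π.f 0).hom y) := by
    intro y
    induction y using TensorProduct.induction_on with
    | zero =>
      refine (map_zero ε.hom).trans ?_
      rw [map_zero]; exact (map_zero (mulMap φ)).symm
    | add a b ha hb =>
      refine (map_add ε.hom a b).trans ?_
      rw [map_add]; exact (congrArg₂ (· + ·) ha hb).trans (map_add (mulMap φ) _ _).symm
    | tmul s p => rfl
  have hπ : Function.Surjective (P.π.f 0).hom := (ModuleCat.epi_iff_surjective _).1 inferInstance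
  have hexR : Function.Exact (P.complex.d 1 0).hom (P.π.f 0).hom := by
    have := P.exact₀
    exact (ShortComplex.ShortExact.moduleCat_exact_iff_function_exact _).1 this
  have hex0 : ∀ y : E.obj (P.complex.X 0), ε.hom y = 0 → ∃ z, (d 0).hom z = y := by
    intro y hy
    have hy' := hmul (((hε y).symm.trans hy).trans (map_zero (mulMap φ)).symm)
    exact ((lTensor_exact (SasR φ) hexR hπ) y).1 hy'
  have hdε : d 0 ≫ ε = 0 := by
    refine ModuleCat.hom_ext (LinearMap.ext fun z => ?_)
    have := (lTensor_exact (SasR φ) hexR hπ).apply_apply_eq_zero z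
    exact (hε _).trans ((congrArg (mulMap φ) this).trans (map_zero (mulMap φ)))
  obtain ⟨x0, hx0⟩ : ∃ x0 : E.obj (P.complex.X 0), ε.hom x0 = (1 : S) := by
    obtain ⟨p, hp⟩ := hπ (show SasR φ from (1 : S))
    refine ⟨TensorProduct.tmul R (show SasR φ from (1 : S)) p, ?_⟩
    refine (hε _).trans ?_
    change (1 : S) • (show S from (P.π.f 0).hom p) = 1
    rw [one_smul]; exact hp
  let σ : ModuleCat.of S S ⟶ E.obj (P.complex.X 0) := spanHom _ x0
  have hσ : σ ≫ ε = 𝟙 _ := by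
    ext
    exact (congrArg ε.hom (one_smul S x0)).trans hx0
  have key : ∀ n, ∃ (r : E.obj (P.complex.X n) ⟶ E.obj (P.complex.X (n + 1)))
      (s : E.obj (P.complex.X (n + 1)) ⟶ E.obj (P.complex.X (n + 2))),
      s ≫ d (n + 1) = 𝟙 _ - d n ≫ r := by
    intro n
    induction n with
    | zero =>
      obtain ⟨r, hr⟩ := lift_of_exact (𝟙 _ - ε ≫ σ) (d 0) ε hex0
        (by rw [Preadditive.sub_comp, Category.assoc, hσ]; simp)
      obtain ⟨s, hs⟩ := lift_of_exact (𝟙 _ - d 0 ≫ r) (d 1) (d 0) (hex 0)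
        (by rw [Preadditive.sub_comp, Category.assoc, hr, Preadditive.comp_sub,
          ← Category.assoc (d 0) ε σ, hdε]; simp)
      exact ⟨r, s, hs⟩
    | succ n ih =>
      obtain ⟨r, s, h⟩ := ih
      obtain ⟨t, ht⟩ := lift_of_exact (𝟙 _ - d (n + 1) ≫ s) (d (n + 2)) (d (n + 1)) (hex (n + 1))
        (by rw [Preadditive.sub_comp, Category.assoc, h, Preadditive.comp_sub,
          ← Category.assoc (d (n + 1)) (d n) r, hdd]; simp)
      exact ⟨s, t, ht⟩
  obtain ⟨r, s, hrs⟩ := key n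
  rw [subsingleton_iff_forall_eq 0]
  intro e
  obtain ⟨f, hf, rfl⟩ := P.extMk_surjective e (n + 2) rfl
  rw [P.extMk_eq_zero_iff f (n + 2) rfl hf n rfl]
  let f' : E.obj (P.complex.X (n + 1)) ⟶ M := (adj.homEquiv _ _).symm f
  have hf' : d (n + 1) ≫ f' = 0 := by
    have : (adj.homEquiv _ _) (d (n + 1) ≫ f') = P.complex.d (n + 2) (n + 1) ≫ f := by
      rw [Adjunction.homEquiv_naturality_left]
      simp [f']
    rw [hf] at this
    apply (adj.homEquiv _ _).injective
    rw [this]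
    ext p
    rfl
  have h3 : f' = d n ≫ r ≫ f' := by
    have : (s ≫ d (n + 1)) ≫ f' = 0 := by rw [Category.assoc, hf', comp_zero]
    rw [hrs, Preadditive.sub_comp, sub_eq_zero] at this
    simpa using this
  refine ⟨(adj.homEquiv _ _) (r ≫ f'), ?_⟩
  rw [← Adjunction.homEquiv_naturality_left]
  change adj.homEquiv _ _ (d n ≫ r ≫ f') = f
  rw [← h3]
  simp [f']

/-- A linear map as a morphism in `ModuleCat`. -/
def mkHom {X Y : ModuleCat.{u} R} (f : X →ₗ[R] Y) : X ⟶ Y := ModuleCat.ofHom f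

lemma exists_cycle {ι : Type*} {c : ComplexShape ι} (K : HomologicalComplex (ModuleCat.{u} R) c)
    (i j : ι) (hj : c.next i = j) (x : K.X i) (hx : (K.d i j).hom x = 0) :
    ∃ z : K.cycles i, (K.iCycles i).hom z = x := by
  have h : spanHom (K.X i) x ≫ K.d i j = 0 := by
    ext
    exact (congrArg (K.d i j).hom (one_smul R x)).trans hx
  refine ⟨(K.liftCycles _ j hj h).hom (1 : R), ?_⟩
  have := K.liftCycles_i _ j hj h
  exact (congrArg (fun t => t.hom (1 : R)) this).trans (one_smul R x)

lemma d_iCycles {ι : Type*} {c : ComplexShape ι} (K : HomologicalComplex (ModuleCat.{u} R) c)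
    (i j : ι) (z : K.cycles i) : (K.d i j).hom ((K.iCycles i).hom z) = 0 :=
  congrArg (fun t => t.hom z) (K.iCycles_d i j)

lemma homologyπ_eq_zero {ι : Type*} {c : ComplexShape ι} (K : HomologicalComplex (ModuleCat.{u} R) c)
    (i j : ι) (hi : c.prev j = i) (z : K.cycles j) :
    (K.homologyπ j).hom z = 0 ↔ ∃ y : K.X i, (K.d i j).hom y = (K.iCycles j).hom z := by
  have hinj : Function.Injective (K.iCycles j).hom := (ModuleCat.mono_iff_injective _).1 inferInstance
  have h := ShortComplex.exact_of_g_is_cokernel (.mk (K.toCycles i j) (K.homologyπ j) (by simp))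
    (K.homologyIsCokernel i j hi)
  rw [ShortComplex.moduleCat_exact_iff] at h
  have e : ∀ y, (K.iCycles j).hom ((K.toCycles i j).hom y) = (K.d i j).hom y := fun y =>
    congrArg (fun t => t.hom y) (K.toCycles_i i j)
  constructor
  · intro hz
    obtain ⟨y, hy⟩ := h z hz
    exact ⟨y, (e y).symm.trans (congrArg (K.iCycles j).hom hy)⟩
  · rintro ⟨y, hy⟩
    have : z = (K.toCycles i j).hom y := hinj (hy.symm.trans (e y).symm)
    rw [this]
    exact congrArg (fun t => t.hom y) (K.toCycles_comp_homologyπ i j)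

/-- Elementwise criterion for a quasi-isomorphism of complexes of modules. -/
def ElemQI {K L : CochainComplex (ModuleCat.{u} R) ℤ} (f : K ⟶ L) : Prop :=
  ∀ i : ℤ, (∀ (y : K.X (i + 1)), (K.d (i + 1) (i + 1 + 1)).hom y = 0 →
      ∀ z : L.X i, (f.f (i + 1)).hom y = (L.d i (i + 1)).hom z →
        ∃ y' : K.X i, (K.d i (i + 1)).hom y' = y) ∧
    (∀ z : L.X (i + 1), (L.d (i + 1) (i + 1 + 1)).hom z = 0 →
      ∃ (y : K.X (i + 1)) (z' : L.X i), (K.d (i + 1) (i + 1 + 1)).hom y = 0 ∧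
        z = (f.f (i + 1)).hom y + (L.d i (i + 1)).hom z')

lemma quasiIso_iff_elemQI {K L : CochainComplex (ModuleCat.{u} R) ℤ} (f : K ⟶ L) :
    QuasiIso f ↔ ElemQI f := by
  have h0 : QuasiIso f ↔ ∀ i : ℤ, QuasiIsoAt f (i + 1) :=
    ⟨fun _ _ => inferInstance, fun h => ⟨fun i => by simpa using h (i - 1)⟩⟩
  rw [h0]
  refine forall_congr' fun i => ?_
  rw [quasiIsoAt_iff_isIso_homologyMap, ConcreteCategory.isIso_iff_bijective]
  have hπK : Function.Surjective (K.homologyπ (i + 1)).hom :=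
    (ModuleCat.epi_iff_surjective _).1 inferInstance
  have hπL : Function.Surjective (L.homologyπ (i + 1)).hom :=
    (ModuleCat.epi_iff_surjective _).1 inferInstance
  have nat : ∀ z, (HomologicalComplex.homologyMap f (i + 1)).hom ((K.homologyπ (i + 1)).hom z) =
      (L.homologyπ (i + 1)).hom ((HomologicalComplex.cyclesMap f (i + 1)).hom z) := fun z =>
    congrArg (fun t => t.hom z) (HomologicalComplex.homologyπ_naturality f (i + 1))
  have nat2 : ∀ z, (L.iCycles (i + 1)).hom ((HomologicalComplex.cyclesMap f (i + 1)).hom z) =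
      (f.f (i + 1)).hom ((K.iCycles (i + 1)).hom z) := fun z =>
    congrArg (fun t => t.hom z) (HomologicalComplex.cyclesMap_i f (i + 1))
  have hprev : (ComplexShape.up ℤ).prev (i + 1) = i := by simp
  have hnext : (ComplexShape.up ℤ).next (i + 1) = i + 1 + 1 := by simp
  change Function.Injective (HomologicalComplex.homologyMap f (i + 1)).hom ∧
    Function.Surjective (HomologicalComplex.homologyMap f (i + 1)).hom ↔ _
  refine and_congr ?_ ?_
  · rw [injective_iff_map_eq_zero]
    constructor
    · intro h y hy z hz
      obtain ⟨y, rfl⟩ := exists_cycle K _ _ hnext y hy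
      have h1 := h ((K.homologyπ (i + 1)).hom y) (by
        rw [nat, homologyπ_eq_zero L _ _ hprev]
        exact ⟨z, by rw [nat2, hz]⟩)
      rwa [homologyπ_eq_zero K _ _ hprev] at h1
    · intro h a ha
      obtain ⟨a, rfl⟩ := hπK a
      rw [nat, homologyπ_eq_zero L _ _ hprev] at ha
      obtain ⟨z, hz⟩ := ha
      rw [homologyπ_eq_zero K _ _ hprev]
      exact h _ (d_iCycles _ _ _ _) z (by rw [hz, nat2])
  · constructor
    · intro h z hz
      obtain ⟨z, rfl⟩ := exists_cycle L _ _ hnext z hz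
      obtain ⟨a, ha⟩ := h ((L.homologyπ (i + 1)).hom z)
      obtain ⟨y, rfl⟩ := hπK a
      rw [nat, ← sub_eq_zero, ← map_sub, ← neg_eq_zero, ← map_neg, neg_sub,
        homologyπ_eq_zero L _ _ hprev] at ha
      obtain ⟨w, hw⟩ := ha
      refine ⟨(K.iCycles (i + 1)).hom y, w, d_iCycles _ _ _ _, ?_⟩
      rw [hw, map_sub, nat2]
      abel
    · intro h a
      obtain ⟨z, rfl⟩ := hπL a
      obtain ⟨y, z', hy, hz⟩ := h _ (d_iCycles L _ _ z)
      obtain ⟨y, rfl⟩ := exists_cycle K _ _ hnext y hy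
      refine ⟨(K.homologyπ (i + 1)).hom y, ?_⟩
      rw [nat, ← sub_eq_zero, ← map_sub, ← neg_eq_zero, ← map_neg, neg_sub,
        homologyπ_eq_zero L _ _ hprev]
      refine ⟨z', ?_⟩
      rw [map_sub, hz, nat2]
      abel

open Abelian in
lemma acyclic_hom [HasExt.{w} (ModuleCat.{u} R)] (A : ModuleCat.{u} R) (X : ℤ → ModuleCat.{u} R)
    (d : ∀ n, X n ⟶ X (n + 1)) (hdd : ∀ n, d n ≫ d (n + 1) = 0)
    (hex : ∀ n (x : X (n + 1)), (d (n + 1)).hom x = 0 → ∃ y, (d n).hom y = x)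
    (N : ℤ) (hN : ∀ n, n < N → ∀ x : X n, x = 0)
    (hA : ∀ n i, Subsingleton (Ext.{w} A (X n) (i + 1)))
    (n : ℤ) (f : A ⟶ X (n + 1)) (hf : f ≫ d (n + 1) = 0) : ∃ g : A ⟶ X n, g ≫ d n = f := by
  let Z : ℤ → ModuleCat.{u} R := fun n => ModuleCat.of R (LinearMap.ker (d n).hom)
  let ι : ∀ n, Z n ⟶ X n := fun n => ModuleCat.ofHom (Submodule.subtype _)
  let π : ∀ n, X n ⟶ Z (n + 1) := fun n => ModuleCat.ofHom
    ((d n).hom.codRestrict _ (fun x => LinearMap.mem_ker.2 (congrArg (fun t : X n ⟶ X (n + 1 + 1) => t.hom x) (hdd n))))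
  have hπι : ∀ n, π n ≫ ι (n + 1) = d n := fun n => rfl
  have hι : ∀ n, Mono (ι n) := fun n => by
    rw [ModuleCat.mono_iff_injective]; exact Subtype.val_injective
  have hz : ∀ n, ι n ≫ π n = 0 := fun n => by
    ext x; exact LinearMap.mem_ker.1 x.2
  have hS : ∀ n, (ShortComplex.mk (ι n) (π n) (hz n)).ShortExact := fun n =>
    { exact := by
        rw [ShortComplex.moduleCat_exact_iff]
        intro x hx
        exact ⟨⟨x, congrArg Subtype.val hx⟩, rfl⟩
      mono_f := hι n
      epi_g := by
        rw [ModuleCat.epi_iff_surjective]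
        rintro ⟨x, hx⟩
        obtain ⟨y, hy⟩ := hex n x hx
        exact ⟨y, Subtype.ext hy⟩ }
  have key : ∀ (k : ℕ) (n : ℤ), n < N + k → ∀ i, Subsingleton (Ext.{w} A (Z n) (i + 1)) := by
    intro k
    induction k with
    | zero =>
      intro n hn i
      have : IsZero (Z n) := by
        apply ModuleCat.isZero_of_iff_subsingleton.2
        exact ⟨fun a b => Subtype.ext ((hN n (by simpa using hn) _).trans
          (hN n (by simpa using hn) _).symm)⟩
      refine (subsingleton_iff_forall_eq 0).2 fun e => ?_
      rw [← e.comp_mk₀_id, this.eq_of_src (𝟙 (Z n)) 0, Ext.mk₀_zero, Ext.comp_zero]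
    | succ k ih =>
      intro n hn i
      obtain ⟨m, rfl⟩ : ∃ m, n = m + 1 := ⟨n - 1, by omega⟩
      refine (subsingleton_iff_forall_eq 0).2 fun e => ?_
      have h1 := ih m (by push_cast at hn; omega) (i + 1)
      obtain ⟨e', rfl⟩ := Ext.covariant_sequence_exact₃ A (hS m) e rfl (h1.elim _ _)
      rw [(hA m i).elim e' 0]
      exact Ext.zero_comp _ _ _ _ _
  have h1 := key (n - N + 1).toNat n (by omega) 0
  let f' : A ⟶ Z (n + 1) := ModuleCat.ofHom
    (f.hom.codRestrict _ (fun x => LinearMap.mem_ker.2 (congrArg (fun t : A ⟶ X (n + 1 + 1) => t.hom x) hf)))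
  have hf' : f' ≫ ι (n + 1) = f := rfl
  obtain ⟨e, he⟩ := Ext.covariant_sequence_exact₃ A (hS n) (Ext.mk₀ f') rfl (h1.elim _ _)
  obtain ⟨g, rfl⟩ := (Ext.mk₀_bijective _ _).2 e
  rw [Ext.mk₀_comp_mk₀] at he
  have he : g ≫ π n = f' := (Ext.mk₀_bijective _ _).1 he
  exact ⟨g, by rw [← hf', ← he, Category.assoc, hπι]⟩

open Abelian in
lemma subsingleton_ext_prod [HasExt.{w} (ModuleCat.{u} R)] (A M N : ModuleCat.{u} R) (i : ℕ)
    (hM : Subsingleton (Ext.{w} A M i)) (hN : Subsingleton (Ext.{w} A N i)) :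
    Subsingleton (Ext.{w} A (ModuleCat.of R (M × N)) i) := by
  refine (subsingleton_iff_forall_eq 0).2 fun e => ?_
  let p₁ : ModuleCat.of R (M × N) ⟶ M := ModuleCat.ofHom (LinearMap.fst R M N)
  let p₂ : ModuleCat.of R (M × N) ⟶ N := ModuleCat.ofHom (LinearMap.snd R M N)
  let i₁ : M ⟶ ModuleCat.of R (M × N) := ModuleCat.ofHom (LinearMap.inl R M N)
  let i₂ : N ⟶ ModuleCat.of R (M × N) := ModuleCat.ofHom (LinearMap.inr R M N)
  have h : 𝟙 (ModuleCat.of R (M × N)) = p₁ ≫ i₁ + p₂ ≫ i₂ := by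
    refine ModuleCat.hom_ext (LinearMap.ext fun x => ?_)
    change x = (x.1, 0) + (0, x.2)
    simp
  rw [← e.comp_mk₀_id, h, Ext.mk₀_add, Ext.comp_add, ← Ext.mk₀_comp_mk₀, ← Ext.mk₀_comp_mk₀,
    ← Ext.comp_assoc_of_third_deg_zero, ← Ext.comp_assoc_of_third_deg_zero,
    hM.elim (e.comp (Ext.mk₀ p₁) _) 0, hN.elim (e.comp (Ext.mk₀ p₂) _) 0, Ext.zero_comp,
    Ext.zero_comp, add_zero]

/-- differential of the cone -/
def coneD {K J : CochainComplex (ModuleCat.{u} R) ℤ} (j : K ⟶ J) (n : ℤ) :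
    ModuleCat.of R (K.X (n + 1) × J.X n) ⟶ ModuleCat.of R (K.X (n + 1 + 1) × J.X (n + 1)) :=
  ModuleCat.ofHom (LinearMap.prod (-((K.d (n + 1) (n + 1 + 1)).hom.comp (LinearMap.fst R _ _)))
    ((j.f (n + 1)).hom.comp (LinearMap.fst R _ _) + (J.d n (n + 1)).hom.comp (LinearMap.snd R _ _)))

lemma coneD_apply {K J : CochainComplex (ModuleCat.{u} R) ℤ} (j : K ⟶ J) (n : ℤ)
    (x : K.X (n + 1)) (y : J.X n) : (coneD j n).hom (x, y) =
      (-(K.d (n + 1) (n + 1 + 1)).hom x, (j.f (n + 1)).hom x + (J.d n (n + 1)).hom y) := rfl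

lemma dd_elem (K : CochainComplex (ModuleCat.{u} R) ℤ) (a b c : ℤ) (x : K.X a) :
    (K.d b c).hom ((K.d a b).hom x) = 0 := congrArg (fun t => t.hom x) (K.d_comp_d a b c)

lemma comm_elem {K L : CochainComplex (ModuleCat.{u} R) ℤ} (j : K ⟶ L) (a b : ℤ) (x : K.X a) :
    (j.f b).hom ((K.d a b).hom x) = (L.d a b).hom ((j.f a).hom x) :=
  (congrArg (fun t => t.hom x) (j.comm a b)).symm

open Abelian in
lemma cone_hom [HasExt.{w} (ModuleCat.{u} R)] {K J : CochainComplex (ModuleCat.{u} R) ℤ} (j : K ⟶ J)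
    (hj : ElemQI j) (A : ModuleCat.{u} R) (N : ℤ)
    (hK : ∀ n, n < N → ∀ x : K.X n, x = 0) (hJ : ∀ n, n < N → ∀ x : J.X n, x = 0)
    (hAK : ∀ n i, Subsingleton (Ext.{w} A (K.X n) (i + 1)))
    (hAJ : ∀ n i, Subsingleton (Ext.{w} A (J.X n) (i + 1)))
    (n : ℤ) (a : A ⟶ K.X (n + 1 + 1)) (b : A ⟶ J.X (n + 1))
    (ha : ∀ s, (K.d _ (n + 1 + 1 + 1)).hom (a.hom s) = 0)
    (hb : ∀ s, (j.f (n + 1 + 1)).hom (a.hom s) + (J.d _ (n + 1 + 1)).hom (b.hom s) = 0) :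
    ∃ (a' : A ⟶ K.X (n + 1)) (b' : A ⟶ J.X n), 
      (∀ s, (K.d _ (n + 1 + 1)).hom (a'.hom s) = - a.hom s) ∧
      (∀ s, (j.f (n + 1)).hom (a'.hom s) + (J.d n (n + 1)).hom (b'.hom s) = b.hom s) := by
  obtain ⟨g, hg⟩ := acyclic_hom.{w} A (fun n => ModuleCat.of R (K.X (n + 1) × J.X n)) (coneD j)
    (fun n => ModuleCat.hom_ext (LinearMap.ext fun x => by
      obtain ⟨x, y⟩ := x
      change (coneD j (n + 1)).hom ((coneD j n).hom (x, y)) = 0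
      rw [coneD_apply, coneD_apply, map_neg, dd_elem, map_add, dd_elem, map_neg, comm_elem]
      ext <;> simp))
    (fun n x hx => by
      obtain ⟨x, y⟩ := x
      rw [coneD_apply] at hx
      have h1 := congrArg Prod.fst hx
      have h2 := congrArg Prod.snd hx
      change - _ = 0 at h1
      change _ + _ = 0 at h2
      rw [neg_eq_zero] at h1
      obtain ⟨x', hx'⟩ := (hj (n + 1)).1 x h1 (-y) (by rw [map_neg]; exact eq_neg_of_add_eq_zero_left h2)
      obtain ⟨x'', w, hx'', hw⟩ := (hj n).2 ((j.f _).hom x' + y) (by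
        rw [map_add, ← comm_elem, hx', h2])
      refine ⟨(x'' - x', w), ?_⟩
      rw [coneD_apply]
      refine Prod.ext ?_ ?_
      · change - _ = x
        rw [map_sub, hx'', hx']; simp
      · change _ + _ = y
        have : y = (j.f (n + 1)).hom x'' + (J.d n (n + 1)).hom w - (j.f (n + 1)).hom x' := by
          rw [← hw]; abel
        rw [this, map_sub]; abel)
    (N - 1)
    (fun n hn x => Prod.ext (hK _ (by omega) _) (hJ _ (by omega) _))
    (fun n i => subsingleton_ext_prod A _ _ _ (hAK _ _) (hAJ _ _))
    n (ModuleCat.ofHom (LinearMap.prod a.hom b.hom))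
    (by
      refine ModuleCat.hom_ext (LinearMap.ext fun x => ?_)
      refine (coneD_apply j (n + 1) (a.hom x) (b.hom x)).trans ?_
      rw [ha, hb]; ext <;> simp)
  refine ⟨ModuleCat.ofHom ((LinearMap.fst R _ _).comp g.hom),
    ModuleCat.ofHom ((LinearMap.snd R _ _).comp g.hom), fun s => ?_, fun s => ?_⟩
  · have := congrArg (fun t => (t.hom s).1) hg
    have h : -(K.d (n + 1) (n + 1 + 1)).hom (g.hom s).1 = a.hom s := this
    rw [← h, neg_neg]; rfl
  · exact congrArg (fun t => (t.hom s).2) hg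

/-- `s ↦ j (s • y)`. -/
def evJ {Y : CochainComplex (ModuleCat.{u} S) ℤ} {J : CochainComplex (ModuleCat.{u} R) ℤ}
    (j : ((ModuleCat.restrictScalars.{u} φ).mapHomologicalComplex _).obj Y ⟶ J) (i : ℤ) (y : Y.X i) :
    SasR φ ⟶ J.X i := mkHom (etaMap φ (Y.X i) y) ≫ j.f i

/-- Complexes `Y` admitting a K-injective resolution computing `RHom_R(S, Y)` as `Y`. -/
def Nice (Y : CochainComplex (ModuleCat.{u} S) ℤ) : Prop :=
  ∃ (J : CochainComplex (ModuleCat.{u} R) ℤ) (_ : J.IsKInjective)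
    (j : ((ModuleCat.restrictScalars.{u} φ).mapHomologicalComplex _).obj Y ⟶ J),
    ElemQI j ∧ ∀ i : ℤ,
      (∀ y : Y.X (i + 1), (Y.d (i + 1) (i + 1 + 1)).hom y = 0 →
        ∀ h : SasR φ ⟶ J.X i, evJ φ j (i + 1) y = h ≫ J.d i (i + 1) →
        ∃ y' : Y.X i, (Y.d i (i + 1)).hom y' = y) ∧
      (∀ g : SasR φ ⟶ J.X (i + 1), g ≫ J.d (i + 1) (i + 1 + 1) = 0 →
        ∃ (y : Y.X (i + 1)) (h : SasR φ ⟶ J.X i), (Y.d (i + 1) (i + 1 + 1)).hom y = 0 ∧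
          g = evJ φ j (i + 1) y + h ≫ J.d i (i + 1))

lemma elem_zero_of_strictlyGE (K : CochainComplex (ModuleCat.{u} R) ℤ) (N : ℤ) [K.IsStrictlyGE N] :
    ∀ n, n < N → ∀ x : K.X n, x = 0 := by
  intro n hn x
  have h := K.isZero_of_isStrictlyGE N n hn
  exact congrArg (fun t => t.hom x) (h.eq_of_src (𝟙 _) 0)

lemma nice_of_bounded [HasExt.{w} (ModuleCat.{u} R)]
    (h3 : ∀ M : ModuleCat.{u} S, Function.Bijective (etaMap φ M) ∧ ∀ i : ℕ, 1 ≤ i →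
      Subsingleton (Abelian.Ext.{w} (SasR φ) ((ModuleCat.restrictScalars φ).obj M) i))
    (Y : CochainComplex (ModuleCat.{u} S) ℤ) (N : ℤ) (hY : ∀ n, n < N → ∀ x : Y.X n, x = 0) :
    Nice φ Y := by
  let FY : CochainComplex (ModuleCat.{u} R) ℤ :=
    ((ModuleCat.restrictScalars.{u} φ).mapHomologicalComplex (ComplexShape.up ℤ)).obj Y
  have hFY : ∀ n, n < N → ∀ x : FY.X n, x = 0 := hY
  have : CochainComplex.IsStrictlyGE FY N := by
    rw [CochainComplex.isStrictlyGE_iff]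
    intro i hi
    rw [ModuleCat.isZero_of_iff_subsingleton]
    exact ⟨fun a b => (hFY i hi a).trans (hFY i hi b).symm⟩
  obtain ⟨J, j, hj, hinj, hJ⟩ := CochainComplex.Plus.modelCategoryQuillen.exists_quasiIso_injective FY N
  have hj' := (quasiIso_iff_elemQI j).1 hj
  have hJK := CochainComplex.isKInjective_of_injective J N
  have key := cone_hom.{w} j hj' (SasR φ) N hFY (elem_zero_of_strictlyGE J N)
    (fun n i => (h3 (Y.X n)).2 (i + 1) (by omega))
    (fun n i => (subsingleton_iff_forall_eq 0).2 fun e => by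
      have := hinj n
      exact e.eq_zero_of_injective)
  have hd : ∀ i k (y : Y.X i) (s : SasR φ), (FY.d i k).hom (etaMap φ (Y.X i) y s) =
      etaMap φ (Y.X k) ((Y.d i k).hom y) s := fun i k y s =>
    (Y.d i k).hom.map_smul (show S from s) y
  have h0 : ∀ i s, etaMap φ (Y.X i) 0 s = 0 := fun i s =>
    smul_zero (A := Y.X i) (show S from s)
  have one : ∀ i y, etaMap φ (Y.X i) y (1 : S) = y := fun i y => one_smul S (show Y.X i from y)
  refine ⟨J, hJK, j, hj', fun i => ⟨fun y hy h hh => ?_, fun g hg => ?_⟩⟩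
  · obtain ⟨m, rfl⟩ : ∃ m, i = m + 1 := ⟨i - 1, by omega⟩
    obtain ⟨a', b', h1, h2⟩ := key m (mkHom (etaMap φ (Y.X _) y)) (-h) (fun s => by
        refine (hd _ _ y s).trans ?_
        rw [hy]; exact h0 _ s) (fun s => by
        have := congrArg (fun t => t.hom s) hh
        change (j.f _).hom _ = (J.d _ _).hom (h.hom s) at this
        change (j.f _).hom _ + (J.d _ _).hom (-(h.hom s)) = 0
        rw [map_neg, add_neg_eq_zero]
        exact this)
    refine ⟨-(show Y.X (m + 1) from a'.hom (1 : S)), ?_⟩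
    rw [map_neg]
    have := h1 (1 : S)
    have e : (Y.d (m + 1) (m + 1 + 1)).hom (show Y.X (m + 1) from a'.hom (1 : S)) = - y := by
      refine this.trans ?_
      exact congrArg (fun t => -t) (one _ y)
    rw [e, neg_neg]
  · obtain ⟨a', b', h1, h2⟩ := key i 0 g (fun s => map_zero _) (fun s => by
        have := congrArg (fun t => t.hom s) hg
        change (j.f _).hom 0 + _ = 0
        rw [map_zero, zero_add]; exact this)
    obtain ⟨y, hy⟩ := (h3 (Y.X (i + 1))).1.2 a'.hom
    refine ⟨y, b', ?_, ?_⟩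
    · refine (one _ _).symm.trans ((hd _ _ y (1 : S)).symm.trans ?_)
      have := h1 (1 : S)
      rw [← hy] at this
      refine this.trans ?_
      exact neg_zero
    · refine ModuleCat.hom_ext (LinearMap.ext fun s => ?_)
      have := h2 s
      rw [← hy] at this
      exact this.symm

/-- Countable product of complexes of modules. -/
def piCx (K : ℕ → CochainComplex (ModuleCat.{u} R) ℤ) : CochainComplex (ModuleCat.{u} R) ℤ where
  X i := ModuleCat.of R (∀ n, (K n).X i)
  d i j := ModuleCat.ofHom (LinearMap.pi fun n => ((K n).d i j).hom.comp (LinearMap.proj n))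
  shape i j hij := ModuleCat.hom_ext (LinearMap.ext fun x => funext fun n =>
    congrArg (fun t => t.hom (x n)) ((K n).shape i j hij))
  d_comp_d' i j k _ _ := ModuleCat.hom_ext (LinearMap.ext fun x => funext fun n =>
    congrArg (fun t => t.hom (x n)) ((K n).d_comp_d i j k))

/-- projection -/
def piProj (K : ℕ → CochainComplex (ModuleCat.{u} R) ℤ) (n : ℕ) : piCx K ⟶ K n where
  f _ := ModuleCat.ofHom (LinearMap.proj n)
  comm' _ _ _ := rfl

/-- lift -/
def piLift (K : ℕ → CochainComplex (ModuleCat.{u} R) ℤ) {X : CochainComplex (ModuleCat.{u} R) ℤ}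
    (f : ∀ n, X ⟶ K n) : X ⟶ piCx K where
  f i := ModuleCat.ofHom (LinearMap.pi fun n => ((f n).f i).hom)
  comm' i j _ := ModuleCat.hom_ext (LinearMap.ext fun x => funext fun n =>
    congrArg (fun t => t.hom x) ((f n).comm i j))

lemma isKInjective_piCx (K : ℕ → CochainComplex (ModuleCat.{u} R) ℤ) (hK : ∀ n, (K n).IsKInjective) :
    (piCx K).IsKInjective where
  nonempty_homotopy_zero {X} f hX := by
    have h : ∀ n, Nonempty (Homotopy (f ≫ piProj K n) 0) := fun n =>
      (hK n).nonempty_homotopy_zero _ hX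
    let h : ∀ n, Homotopy (f ≫ piProj K n) 0 := fun n => (h n).some
    let H : ∀ i j, X.X i ⟶ (piCx K).X j := fun i j =>
      ModuleCat.ofHom (LinearMap.pi fun n => ((h n).hom i j).hom)
    have hH : ∀ i j n, H i j ≫ (piProj K n).f j = (h n).hom i j := fun i j n => rfl
    refine ⟨{ hom := H
              zero := fun i j hij => ModuleCat.hom_ext (LinearMap.ext fun x => funext fun n =>
                congrArg (fun t => t.hom x) ((h n).zero i j hij))
              comm := fun i => ?_ }⟩
    clear_value H
    rw [dNext_eq _ (show (ComplexShape.up ℤ).Rel i (i + 1) from rfl),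
      prevD_eq _ (show (ComplexShape.up ℤ).Rel (i - 1) i by simp)]
    refine ModuleCat.hom_ext (LinearMap.ext fun x => funext fun n => ?_)
    have := (h n).comm i
    rw [dNext_eq _ (show (ComplexShape.up ℤ).Rel i (i + 1) from rfl),
      prevD_eq _ (show (ComplexShape.up ℤ).Rel (i - 1) i by simp), ← hH, ← hH] at this
    exact congrArg (fun t => t.hom x) this

/-- map into a product -/
def piHom {A : ModuleCat.{u} R} (X : ℕ → ModuleCat.{u} R) (f : ∀ n, A ⟶ X n) :
    A ⟶ ModuleCat.of R (∀ n, X n) :=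
  ModuleCat.ofHom (LinearMap.pi fun n => (f n).hom)

lemma nice_piCx (Y : ℕ → CochainComplex (ModuleCat.{u} S) ℤ) (hY : ∀ n, Nice φ (Y n)) :
    Nice φ (piCx Y) := by
  choose J hJ j hj hn using hY
  let jj : ((ModuleCat.restrictScalars.{u} φ).mapHomologicalComplex _).obj (piCx Y) ⟶ piCx J :=
    piLift J (fun n => ((ModuleCat.restrictScalars.{u} φ).mapHomologicalComplex _).map (piProj Y n) ≫ j n)
  refine ⟨piCx J, isKInjective_piCx J hJ, jj, fun i => ⟨fun y hy z hz => ?_, fun z hz => ?_⟩,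
    fun i => ⟨fun y hy z hz => ?_, fun z hz => ?_⟩⟩
  · have h : ∀ n, ∃ y', (((Y n)).d i (i + 1)).hom y' = y n := fun n =>
      (hj n i).1 (y n) (congrFun hy n) (z n) (congrFun hz n)
    choose y' hy' using h
    exact ⟨y', funext hy'⟩
  · have h := fun n => (hj n i).2 (z n) (congrFun hz n)
    choose y' z' h1 h2 using h
    exact ⟨y', z', funext h1, funext h2⟩
  · have h := fun n => (hn n i).1 (y n) (congrFun hy n) (z ≫ (piProj J n).f i) (by
      refine ModuleCat.hom_ext (LinearMap.ext fun s => ?_)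
      exact congrFun (congrArg (fun t => t.hom s) hz) n)
    choose y' hy' using h
    exact ⟨y', funext hy'⟩
  · have h := fun n => (hn n i).2 (z ≫ (piProj J n).f (i + 1)) (by
      refine ModuleCat.hom_ext (LinearMap.ext fun s => ?_)
      exact congrFun (congrArg (fun t => t.hom s) hz) n)
    choose y' z' h1 h2 using h
    refine ⟨y', piHom (fun n => (J n).X i) z', funext h1, ?_⟩
    refine ModuleCat.hom_ext (LinearMap.ext fun s => funext fun n => ?_)
    exact congrArg (fun t => t.hom s) (h2 n)

section Transpose

variable {C D : Type*} [Category* C] [Category* D] [Preadditive C] [Preadditive D]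
  {F : C ⥤ D} {G : D ⥤ C} [F.Additive] [G.Additive] (adj : F ⊣ G)

/-- unit on complexes -/
def unitC (X : CochainComplex C ℤ) :
    X ⟶ (G.mapHomologicalComplex (ComplexShape.up ℤ)).obj
      ((F.mapHomologicalComplex (ComplexShape.up ℤ)).obj X) where
  f i := adj.unit.app (X.X i)
  comm' i j _ := (adj.unit.naturality (X.d i j)).symm

/-- counit on complexes -/
def counitC (J : CochainComplex D ℤ) :
    (F.mapHomologicalComplex (ComplexShape.up ℤ)).obj
      ((G.mapHomologicalComplex (ComplexShape.up ℤ)).obj J) ⟶ J where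
  f i := adj.counit.app (J.X i)
  comm' i j _ := (adj.counit.naturality (J.d i j)).symm

/-- transpose of a map of complexes -/
def transp {X : CochainComplex C ℤ} {J : CochainComplex D ℤ}
    (h : (F.mapHomologicalComplex (ComplexShape.up ℤ)).obj X ⟶ J) :
    X ⟶ (G.mapHomologicalComplex (ComplexShape.up ℤ)).obj J :=
  unitC adj X ≫ (G.mapHomologicalComplex (ComplexShape.up ℤ)).map h

lemma counitC_naturality {X J : CochainComplex D ℤ} (h : X ⟶ J) :
    (F.mapHomologicalComplex (ComplexShape.up ℤ)).map
      ((G.mapHomologicalComplex (ComplexShape.up ℤ)).map h) ≫ counitC adj J =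
    counitC adj X ≫ h := by
  ext i
  exact adj.counit.naturality (h.f i)

lemma unitC_naturality {X J : CochainComplex C ℤ} (h : X ⟶ J) :
    h ≫ unitC adj J = unitC adj X ≫ (G.mapHomologicalComplex (ComplexShape.up ℤ)).map
      ((F.mapHomologicalComplex (ComplexShape.up ℤ)).map h) := by
  ext i
  exact adj.unit.naturality (h.f i)

lemma triangle1 (X : CochainComplex C ℤ) :
    (F.mapHomologicalComplex (ComplexShape.up ℤ)).map (unitC adj X) ≫ counitC adj _ = 𝟙 _ := by
  ext i
  exact adj.left_triangle_components (X.X i)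

lemma triangle2 (X : CochainComplex D ℤ) :
    unitC adj _ ≫ (G.mapHomologicalComplex (ComplexShape.up ℤ)).map (counitC adj X) = 𝟙 _ := by
  ext i
  exact adj.right_triangle_components (X.X i)

lemma transp_counitC {X : CochainComplex C ℤ} {J : CochainComplex D ℤ}
    (h : (F.mapHomologicalComplex (ComplexShape.up ℤ)).obj X ⟶ J) :
    (F.mapHomologicalComplex (ComplexShape.up ℤ)).map (transp adj h) ≫ counitC adj J = h := by
  rw [transp, Functor.map_comp, Category.assoc, counitC_naturality, ← Category.assoc, triangle1,
    Category.id_comp]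

lemma transp_counit_map {X : CochainComplex C ℤ} {J : CochainComplex D ℤ}
    (f : X ⟶ (G.mapHomologicalComplex (ComplexShape.up ℤ)).obj J) :
    transp adj ((F.mapHomologicalComplex (ComplexShape.up ℤ)).map f ≫ counitC adj J) = f := by
  rw [transp, Functor.map_comp, ← Category.assoc, ← unitC_naturality, Category.assoc, triangle2,
    Category.comp_id]

/-- transposing null homotopies -/
def transpHomotopy {X : CochainComplex C ℤ} {J : CochainComplex D ℤ}
    (f g : X ⟶ (G.mapHomologicalComplex (ComplexShape.up ℤ)).obj J)
    (h : Homotopy ((F.mapHomologicalComplex (ComplexShape.up ℤ)).map f ≫ counitC adj J)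
      ((F.mapHomologicalComplex (ComplexShape.up ℤ)).map g ≫ counitC adj J)) :
    Homotopy f g :=
  (Homotopy.ofEq (transp_counit_map adj f).symm).trans
    (((G.mapHomotopy h).compLeft (unitC adj X)).trans (Homotopy.ofEq (transp_counit_map adj g)))

end Transpose

instance coextend_additive : (ModuleCat.coextendScalars.{u, u, u} φ).Additive :=
  (ModuleCat.restrictCoextendScalarsAdj.{u, u, u} φ).right_adjoint_additive

/-- restriction on complexes -/
abbrev FC : CochainComplex (ModuleCat.{u} S) ℤ ⥤ CochainComplex (ModuleCat.{u} R) ℤ :=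
  (ModuleCat.restrictScalars.{u} φ).mapHomologicalComplex (ComplexShape.up ℤ)

/-- coextension on complexes -/
abbrev GC : CochainComplex (ModuleCat.{u} R) ℤ ⥤ CochainComplex (ModuleCat.{u} S) ℤ :=
  (ModuleCat.coextendScalars.{u, u, u} φ).mapHomologicalComplex (ComplexShape.up ℤ)

/-- adjunction -/
abbrev adjRS : ModuleCat.restrictScalars.{u} φ ⊣ ModuleCat.coextendScalars.{u, u, u} φ :=
  ModuleCat.restrictCoextendScalarsAdj.{u, u, u} φ

lemma isKInjective_GC (J : CochainComplex (ModuleCat.{u} R) ℤ) (hJ : J.IsKInjective) :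
    CochainComplex.IsKInjective ((GC φ).obj J) where
  nonempty_homotopy_zero {X} f hX := by
    have hX' : ((FC φ).obj X).Acyclic := by
      intro i
      have := hX i
      rw [exactAt_iff_elem _ (i - 1) i (i + 1) (by simp) (by simp)] at this ⊢
      exact this
    obtain ⟨h⟩ := hJ.nonempty_homotopy_zero ((FC φ).map f ≫ counitC (adjRS φ) J) hX'
    exact ⟨transpHomotopy (adjRS φ) f 0 (h.trans (Homotopy.ofEq (by
      rw [Functor.map_zero]; simp)))⟩

lemma elemQI_FC {X Y : CochainComplex (ModuleCat.{u} S) ℤ} (f : X ⟶ Y) (hf : ElemQI f) :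
    ElemQI ((FC φ).map f) := hf

lemma nice_data (Y : CochainComplex (ModuleCat.{u} S) ℤ) (hY : Nice φ Y) :
    ∃ (J : CochainComplex (ModuleCat.{u} R) ℤ) (_ : J.IsKInjective) (u : Y ⟶ (GC φ).obj J),
      QuasiIso u ∧ QuasiIso (counitC (adjRS φ) J) := by
  obtain ⟨J, hJ, j, hj, hn⟩ := hY
  have hu : ElemQI (transp (adjRS φ) j) := by
    refine fun i => ⟨fun y hy z hz => ?_, fun z hz => ?_⟩
    · refine (hn i).1 y hy (mkHom (ModuleCat.CoextendScalars.equiv φ _ z)) ?_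
      refine ModuleCat.hom_ext ?_
      exact congrArg (ModuleCat.CoextendScalars.equiv φ _) hz
    · obtain ⟨y, h, h1, h2⟩ := (hn i).2 (mkHom (ModuleCat.CoextendScalars.equiv φ _ z))
        (ModuleCat.hom_ext (congrArg (ModuleCat.CoextendScalars.equiv φ _) hz))
      exact ⟨y, (ModuleCat.CoextendScalars.equiv φ _).symm h.hom, h1,
        (ModuleCat.CoextendScalars.equiv φ _).injective (congrArg (fun t => t.hom) h2)⟩
  refine ⟨J, hJ, transp (adjRS φ) j, (quasiIso_iff_elemQI _).2 hu, ?_⟩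
  have h1 : QuasiIso ((FC φ).map (transp (adjRS φ) j)) :=
    (quasiIso_iff_elemQI _).2 (elemQI_FC φ _ hu)
  have h2 : QuasiIso ((FC φ).map (transp (adjRS φ) j) ≫ counitC (adjRS φ) J) := by
    rw [transp_counitC]
    exact (quasiIso_iff_elemQI _).2 hj
  exact quasiIso_of_comp_left ((FC φ).map (transp (adjRS φ) j)) _

/-- quotient of a complex by a family of submodules stable under the differential -/
def quotCx (Y : CochainComplex (ModuleCat.{u} S) ℤ) (N : ∀ i, Submodule S (Y.X i))
    (hN : ∀ i j, N i ≤ (N j).comap (Y.d i j).hom) : CochainComplex (ModuleCat.{u} S) ℤ where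
  X i := ModuleCat.of S (Y.X i ⧸ N i)
  d i j := ModuleCat.ofHom (Submodule.mapQ (N i) (N j) (Y.d i j).hom (hN i j))
  shape i j hij := ModuleCat.hom_ext (LinearMap.ext fun x => by
    obtain ⟨x, rfl⟩ := Submodule.Quotient.mk_surjective _ x
    exact congrArg (fun t => Submodule.Quotient.mk (p := N j) (t.hom x)) (Y.shape i j hij))
  d_comp_d' i j k _ _ := ModuleCat.hom_ext (LinearMap.ext fun x => by
    obtain ⟨x, rfl⟩ := Submodule.Quotient.mk_surjective _ x
    exact congrArg (fun t => Submodule.Quotient.mk (p := N k) (t.hom x)) (Y.d_comp_d i j k))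

section Tower

variable (Y : CochainComplex (ModuleCat.{u} S) ℤ) (N : ℕ → ∀ i, Submodule S (Y.X i))
    (hN : ∀ n i j, N n i ≤ (N n j).comap (Y.d i j).hom)
    (hanti : ∀ n i, N (n + 1) i ≤ N n i)

/-- the map to the product of the quotients -/
def towerF : Y ⟶ piCx (fun n => quotCx Y (N n) (hN n)) where
  f i := ModuleCat.ofHom (LinearMap.pi fun n => (N n i).mkQ)
  comm' _ _ _ := rfl

/-- the map `1 - shift` between products of the quotients -/
def towerG : piCx (fun n => quotCx Y (N n) (hN n)) ⟶ piCx (fun n => quotCx Y (N n) (hN n)) where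
  f i := ModuleCat.ofHom (X := ∀ n, (Y.X i ⧸ N n i)) (Y := ∀ n, (Y.X i ⧸ N n i))
    (LinearMap.pi fun n => (LinearMap.proj n : (∀ n, (Y.X i ⧸ N n i)) →ₗ[S] (Y.X i ⧸ N n i)) -
    (Submodule.factor (hanti n i)).comp (LinearMap.proj (n + 1)))
  comm' i j _ := by
    refine ModuleCat.hom_ext (LinearMap.ext fun x => funext fun n => ?_)
    choose y hy using fun n => Submodule.Quotient.mk_surjective _ (x n)
    obtain rfl : (fun n => Submodule.Quotient.mk (y n)) = x := funext hy
    exact (congrArg (Submodule.Quotient.mk (p := N n j))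
      ((Y.d i j).hom.map_sub (y n) (y (n + 1))))

lemma tower_zero : towerF Y N hN ≫ towerG Y N hN hanti = 0 := by
  ext i x
  refine funext fun n => ?_
  exact sub_self (Submodule.Quotient.mk x : Y.X i ⧸ N n i)

lemma tower_shortExact (hbot : ∀ i, ∃ n, N n i = ⊥) :
    (ShortComplex.mk (towerF Y N hN) (towerG Y N hN hanti) (tower_zero Y N hN hanti)).ShortExact := by
  refine HomologicalComplex.shortExact_of_degreewise_shortExact _ (fun i => ?_)
  obtain ⟨n0, h0⟩ := hbot i
  refine ShortComplex.ShortExact.mk' ?_ ?_ ?_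
  · refine (ShortComplex.moduleCat_exact_iff _).2 fun x hx => ?_
    choose y hy using fun n => Submodule.Quotient.mk_surjective (N n i) (x n)
    have h1 : ∀ n, y n - y (n + 1) ∈ N n i := fun n => by
      rw [← Submodule.Quotient.mk_eq_zero, Submodule.Quotient.mk_sub, hy]
      have h : (show Y.X i ⧸ N n i from x n) -
        Submodule.factor (hanti n i) (show Y.X i ⧸ N (n + 1) i from x (n + 1)) = 0 := congrFun hx n
      have e : Submodule.factor (hanti n i) (show Y.X i ⧸ N (n + 1) i from x (n + 1)) =
          Submodule.Quotient.mk (y (n + 1)) :=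
        (congrArg (Submodule.factor (hanti n i)) (hy (n + 1))).symm
      exact (congrArg (fun t => (show Y.X i ⧸ N n i from x n) - t) e).symm.trans h
    have hle : ∀ k m, k ≤ m → N m i ≤ N k i := fun k m hkm =>
      antitone_nat_of_succ_le (f := fun n => N n i) (fun n => hanti n i) hkm
    have h2 : ∀ k m, k ≤ m → y k - y m ∈ N k i := fun k m hkm => by
      induction m, hkm using Nat.le_induction with
      | base => simp
      | succ m hkm ih =>
        have := add_mem ih (hle k m hkm (h1 m))
        simpa using this
    refine ⟨y n0, funext fun k => ?_⟩
    refine Eq.trans ?_ (hy k)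
    refine (Submodule.Quotient.eq _).2 ?_
    rcases le_total k n0 with h | h
    · rw [← neg_sub]
      exact neg_mem (h2 k n0 h)
    · have := h2 n0 k h
      rw [h0, Submodule.mem_bot] at this
      rw [this]
      exact zero_mem _
  · refine (ModuleCat.mono_iff_injective _).2 fun x y hxy => ?_
    have h := congrFun hxy n0
    have h := (Submodule.Quotient.eq _).1 h
    rw [h0, Submodule.mem_bot] at h
    exact sub_eq_zero.1 h
  · refine (ModuleCat.epi_iff_surjective _).2 fun z => ?_
    choose y hy using fun n => Submodule.Quotient.mk_surjective (N n i) (z n)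
    let x : ℕ → Y.X i := fun n => Nat.rec 0 (fun n a => a - y n) n
    refine ⟨fun n => Submodule.Quotient.mk (x n), funext fun n => ?_⟩
    refine Eq.trans ?_ (hy n)
    have e : x n - x (n + 1) = y n := by
      change x n - (x n - y n) = y n
      abel
    exact congrArg (Submodule.Quotient.mk (p := N n i)) e

end Tower

/-- the subcomplexes used for the truncations -/
def truncN (Y : CochainComplex (ModuleCat.{u} S) ℤ) (n : ℕ) (i : ℤ) : Submodule S (Y.X i) :=
  open Classical in
  if i < -n then ⊤ else if i = -n then LinearMap.range (Y.d (i - 1) i).hom else ⊥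

lemma truncN_stable (Y : CochainComplex (ModuleCat.{u} S) ℤ) (n : ℕ) (i j : ℤ) :
    truncN Y n i ≤ (truncN Y n j).comap (Y.d i j).hom := by
  intro x hx
  rw [Submodule.mem_comap]
  by_cases hij : i + 1 = j
  · obtain rfl : i = j - 1 := by omega
    by_cases h1 : j < -n
    · rw [truncN, if_pos h1]; trivial
    by_cases h2 : j = -n
    · rw [truncN, if_neg h1, if_pos h2]
      exact ⟨x, rfl⟩
    by_cases h3 : j - 1 = -n
    · rw [truncN, if_neg (by omega), if_pos h3] at hx
      obtain ⟨y, rfl⟩ := hx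
      have : (Y.d (j - 1) j).hom ((Y.d (j - 1 - 1) (j - 1)).hom y) = 0 :=
        congrArg (fun t => t.hom y) (Y.d_comp_d (j - 1 - 1) (j - 1) j)
      rw [this]
      exact zero_mem _
    · rw [truncN, if_neg (by omega), if_neg (by omega), Submodule.mem_bot] at hx
      rw [hx, map_zero]
      exact zero_mem _
  · rw [Y.shape i j hij]
    exact zero_mem _

lemma truncN_anti (Y : CochainComplex (ModuleCat.{u} S) ℤ) (n : ℕ) (i : ℤ) :
    truncN Y (n + 1) i ≤ truncN Y n i := by
  by_cases h1 : i < -n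
  · rw [truncN, truncN, if_pos h1]; exact le_top
  · rw [truncN, if_neg (by push_cast; omega), if_neg (by push_cast; omega)]; exact bot_le

lemma truncN_bot (Y : CochainComplex (ModuleCat.{u} S) ℤ) (i : ℤ) : ∃ n, truncN Y n i = ⊥ :=
  ⟨i.natAbs + 1, by rw [truncN, if_neg (by omega), if_neg (by omega)]⟩

lemma nice_trunc [HasExt.{w} (ModuleCat.{u} R)]
    (h3 : ∀ M : ModuleCat.{u} S, Function.Bijective (etaMap φ M) ∧ ∀ i : ℕ, 1 ≤ i →
      Subsingleton (Abelian.Ext.{w} (SasR φ) ((ModuleCat.restrictScalars φ).obj M) i))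
    (Y : CochainComplex (ModuleCat.{u} S) ℤ) :
    Nice φ (piCx fun n => quotCx Y (truncN Y n) (truncN_stable Y n)) := by
  refine nice_piCx φ _ fun n => nice_of_bounded φ h3 _ (-n) fun i hi x => ?_
  obtain ⟨x, rfl⟩ := Submodule.Quotient.mk_surjective _ x
  refine (Submodule.Quotient.mk_eq_zero _).2 ?_
  rw [truncN, if_pos hi]
  trivial

attribute [local instance] CategoryTheory.hasExt_of_hasDerivedCategory

variable [HasDerivedCategory.{w} (ModuleCat.{u} R)]
  [HasDerivedCategory.{w} (ModuleCat.{u} S)]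

lemma extMap_bijective_of_ff (h1 : (Dphi φ).Full) (h2 : (Dphi φ).Faithful) (M M' : ModuleCat.{u} S) (i : ℕ) :
    Function.Bijective (fun e : Abelian.Ext.{w} M M' i => extMap φ e) := by
  have e1 : Function.Bijective (fun e : Abelian.Ext.{w} M M' i => e.hom) :=
    Abelian.Ext.homEquiv.bijective
  have e2 : Function.Bijective (fun f : (singleFunctor (ModuleCat.{u} S) 0).obj M ⟶
      ((singleFunctor (ModuleCat.{u} S) 0).obj M')⟦(i : ℤ)⟧ => (Dphi φ).map f) :=
    ⟨(Dphi φ).map_injective, (Dphi φ).map_surjective⟩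
  let I : (Dphi φ).obj (((singleFunctor (ModuleCat.{u} S) 0).obj M')⟦(i : ℤ)⟧) ≅
      ((singleFunctor (ModuleCat.{u} R) 0).obj ((ModuleCat.restrictScalars φ).obj M'))⟦(i : ℤ)⟧ :=
    ((Dphi φ).commShiftIso (i : ℤ)).app _ ≪≫ (shiftFunctor _ (i : ℤ)).mapIso (singleObjIso φ M')
  have e3 := ((singleObjIso φ M).homCongr I).bijective
  exact Abelian.Ext.homEquiv.symm.bijective.comp (e3.comp (e2.comp e1))

lemma singleObjIso_hom_naturality {M M' : ModuleCat.{u} S} (f : M ⟶ M') :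
    (Dphi φ).map ((singleFunctor _ 0).map f) ≫ (singleObjIso φ M').hom =
      (singleObjIso φ M).hom ≫ (singleFunctor _ 0).map ((ModuleCat.restrictScalars φ).map f) := by
  have h1 := ((SingleFunctors.evaluation _ _ 0).mapIso
      (DerivedCategory.singleFunctorsPostcompQIso (ModuleCat.{u} S))).hom.naturality f
  have h2 := (ModuleCat.restrictScalars.{u} φ).mapDerivedCategoryFactors.hom.naturality
    ((CochainComplex.singleFunctor _ 0).map f)
  have h3 := (HomologicalComplex.singleMapHomologicalComplex
        (ModuleCat.restrictScalars.{u} φ) (ComplexShape.up ℤ) 0).hom.naturality f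
  have h4 := ((SingleFunctors.evaluation _ _ 0).mapIso
      (DerivedCategory.singleFunctorsPostcompQIso (ModuleCat.{u} R))).inv.naturality
        ((ModuleCat.restrictScalars φ).map f)
  have h1' := congrArg (Dphi φ).map h1
  have h3' := congrArg DerivedCategory.Q.map h3
  rw [Functor.map_comp, Functor.map_comp] at h1' h3'
  have a1 : ∀ {C : Type _} [Category.{w} C] {A0 A1 A2 A3 A4 B0 B1 B2 B3 B4 : C} 
    {a0 : A0 ⟶ A1} {a1 : A1 ⟶ A2} {a2 : A2 ⟶ A3} {a3 : A3 ⟶ A4} 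
    {b0 : B0 ⟶ B1} {b1 : B1 ⟶ B2} {b2 : B2 ⟶ B3} {b3 : B3 ⟶ B4}
    {c0 : A0 ⟶ B0} {c1 : A1 ⟶ B1} {c2 : A2 ⟶ B2} {c3 : A3 ⟶ B3} {c4 : A4 ⟶ B4}
    (_ : c0 ≫ b0 = a0 ≫ c1) (_ : c1 ≫ b1 = a1 ≫ c2) (_ : c2 ≫ b2 = a2 ≫ c3) (_ : c3 ≫ b3 = a3 ≫ c4),
    c0 ≫ b0 ≫ b1 ≫ b2 ≫ b3 = (a0 ≫ a1 ≫ a2 ≫ a3) ≫ c4 := by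
    intro C _ A0 A1 A2 A3 A4 B0 B1 B2 B3 B4 a0 a1 a2 a3 b0 b1 b2 b3 c0 c1 c2 c3 c4 h0 h1 h2 h3
    simp only [Category.assoc]
    rw [← Category.assoc, h0, Category.assoc, ← Category.assoc c1, h1, Category.assoc,
      ← Category.assoc c2, h2, Category.assoc, h3]
  exact a1 h1' h2 h3' h4

lemma extMap_mk₀ {M M' : ModuleCat.{u} S} (f : M ⟶ M') :
    extMap.{w} φ (Abelian.Ext.mk₀.{w} f) = Abelian.Ext.mk₀.{w} ((ModuleCat.restrictScalars φ).map f) := by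
  rw [extMap, Equiv.symm_apply_eq]
  change _ = (Abelian.Ext.mk₀.{w} ((ModuleCat.restrictScalars φ).map f)).hom
  rw [Abelian.Ext.mk₀_hom, Abelian.Ext.mk₀_hom, Iso.inv_comp_eq]
  have h := ShiftedHom.map_mk₀ ((0 : ℕ) : ℤ) rfl ((singleFunctor _ 0).map f) (Dphi φ)
  rw [ShiftedHom.map] at h
  rw [← Category.assoc]
  refine (congrArg (fun t => t ≫ (shiftFunctor (DerivedCategory (ModuleCat.{u} R)) ((0 : ℕ) : ℤ)).map
        (singleObjIso φ M').hom) h).trans ?_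
  rw [← ShiftedHom.comp_mk₀ _ ((0 : ℕ) : ℤ) rfl, ← ShiftedHom.mk₀_comp ((0 : ℕ) : ℤ) rfl,
    ShiftedHom.mk₀_comp_mk₀, ShiftedHom.mk₀_comp_mk₀]
  congr 1
  exact singleObjIso_hom_naturality φ f

lemma cond4_to_eta (h : ∀ (M M' : ModuleCat.{u} S),
    Function.Bijective (fun e : Abelian.Ext.{w} M M' 0 => extMap φ e)) : IsEpi φ := by
  apply isEpi_of_eta
  intro M f
  obtain ⟨e, he⟩ := (h (ModuleCat.of S S) M).2 (Abelian.Ext.mk₀.{w} (mkHom f))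
  obtain ⟨g, rfl⟩ := Abelian.Ext.mk₀_bijective.{w} _ _ |>.2 e
  dsimp only at he
  rw [extMap_mk₀] at he
  have he := (Abelian.Ext.mk₀_bijective.{w} _ _).1 he
  refine ⟨g.hom (1 : S), ?_⟩
  refine LinearMap.ext fun s => ?_
  have h1 : f s = g.hom (show S from s) := (congrArg (fun t => t.hom s) he).symm
  refine Eq.trans ?_ h1.symm
  change (show S from s) • g.hom (1 : S) = g.hom (show S from s)
  rw [← map_smul, smul_eq_mul, mul_one]

lemma cond4_to_3 (h : ∀ (M M' : ModuleCat.{u} S) (i : ℕ),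
    Function.Bijective (fun e : Abelian.Ext.{w} M M' i => extMap φ e)) (M : ModuleCat.{u} S) :
    Function.Bijective (etaMap φ M) ∧ ∀ i : ℕ, 1 ≤ i →
      Subsingleton (Abelian.Ext.{w} (SasR φ) ((ModuleCat.restrictScalars φ).obj M) i) := by
  refine ⟨eta_bijective φ (cond4_to_eta φ (fun M M' => h M M' 0)) M, fun i hi => ?_⟩
  obtain ⟨n, rfl⟩ : ∃ n, i = n + 1 := ⟨i - 1, by omega⟩
  have : Projective (ModuleCat.of S S) := (IsProjective.iff_projective S).1 inferInstance
  have : Subsingleton (Abelian.Ext.{w} (ModuleCat.of S S) M (n + 1)) :=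
    (subsingleton_iff_forall_eq 0).2 fun e => e.eq_zero_of_projective
  exact (h (ModuleCat.of S S) M (n + 1)).2.subsingleton

lemma cond4_to_2 (h : ∀ (M M' : ModuleCat.{u} S) (i : ℕ),
    Function.Bijective (fun e : Abelian.Ext.{w} M M' i => extMap φ e)) (M : ModuleCat.{u} S) :
    Function.Bijective (actionMap φ M) ∧ ∀ i : ℕ, 1 ≤ i →
      IsZero (((Tor (ModuleCat.{u} R) i).obj (SasR φ)).obj
        ((ModuleCat.restrictScalars φ).obj M)) := by
  refine ⟨action_bijective φ (cond4_to_eta φ (fun M M' => h M M' 0)) M, fun i hi => ?_⟩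
  obtain ⟨n, rfl⟩ : ∃ n, i = n + 1 := ⟨i - 1, by omega⟩
  apply isZero_Tor_of_ext.{w}
  let C : ModuleCat.{u} S := ModuleCat.of S (CharacterModule S)
  have hC : Module.Injective S (CharacterModule S) :=
    (Module.Flat.iff_characterModule_injective).1 inferInstance
  have : Injective C := (Module.injective_iff_injective_object S _).1 hC
  have h1 : Subsingleton (Abelian.Ext.{w} M C (n + 1)) :=
    (subsingleton_iff_forall_eq 0).2 fun e => e.eq_zero_of_injective
  have h2 := (h M C (n + 1)).2.subsingleton
  exact h2

lemma map_bij_of_iso {C D : Type*} [Category* C] [Category* D] (F : C ⥤ D) {X X' Y Y' : C}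
    (e : X ≅ X') (e' : Y ≅ Y') (h : Function.Bijective (F.map : (X ⟶ Y) → _)) :
    Function.Bijective (F.map : (X' ⟶ Y') → _) := by
  refine ⟨fun f g hfg => ?_, fun β => ?_⟩
  · have := @h.1 (e.hom ≫ f ≫ e'.inv) (e.hom ≫ g ≫ e'.inv) (by simp [hfg])
    simpa using this
  · obtain ⟨α, hα⟩ := h.2 (F.map e.hom ≫ β ≫ F.map e'.inv)
    exact ⟨e.inv ≫ α ≫ e'.hom, by simp [hα]⟩

section QLemmas

variable {C : Type*} [Category* C] [Abelian C] [HasDerivedCategory C]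

lemma Q_map_surj (X J : CochainComplex C ℤ) [J.IsKInjective] (α : Q.obj X ⟶ Q.obj J) :
    ∃ h : X ⟶ J, Q.map h = α := by
  obtain ⟨g, hg⟩ := (CochainComplex.IsKInjective.Qh_map_bijective
    ((HomotopyCategory.quotient C _).obj X) J).2
    ((quotientCompQhIso C).hom.app X ≫ α ≫ (quotientCompQhIso C).inv.app J)
  obtain ⟨h, rfl⟩ := (HomotopyCategory.quotient C _).map_surjective g
  refine ⟨h, ?_⟩
  have := (quotientCompQhIso C).hom.naturality h
  rw [← cancel_epi ((quotientCompQhIso C).hom.app X), ← this, Functor.comp_map]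
  refine (congrArg (fun t => t ≫ (quotientCompQhIso C).hom.app J) hg).trans ?_
  refine (Category.assoc _ _ _).trans (congrArg (fun t => _ ≫ t) ?_)
  refine (Category.assoc _ _ _).trans ((congrArg (fun t => α ≫ t) ?_).trans (Category.comp_id α))
  exact (quotientCompQhIso C).inv_hom_id_app J

lemma Q_map_inj (X J : CochainComplex C ℤ) [J.IsKInjective] (f g : X ⟶ J)
    (h : Q.map f = Q.map g) : Nonempty (Homotopy f g) := by
  have : (HomotopyCategory.quotient C _).map f = (HomotopyCategory.quotient C _).map g := by
    apply (CochainComplex.IsKInjective.Qh_map_bijective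
      ((HomotopyCategory.quotient C _).obj X) J).1
    have h1 := (quotientCompQhIso C).hom.naturality f
    have h2 := (quotientCompQhIso C).hom.naturality g
    rw [h, ← h2, cancel_mono] at h1
    exact h1
  exact ⟨HomotopyCategory.homotopyOfEq _ _ this⟩

end QLemmas

/-- `D(φ)` is bijective on morphisms to `Y` -/
def Good (Y : DerivedCategory (ModuleCat.{u} S)) : Prop :=
  ∀ X, Function.Bijective ((Dphi φ).map : (X ⟶ Y) → _)

lemma good_of_iso {Y Y' : DerivedCategory (ModuleCat.{u} S)} (e : Y ≅ Y') (h : Good φ Y) :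
    Good φ Y' := fun X => map_bij_of_iso (Dphi φ) (Iso.refl X) e (h X)

lemma good_of_nice (Y : CochainComplex (ModuleCat.{u} S) ℤ) (hY : Nice φ Y) :
    Good φ (Q.obj Y) := by
  obtain ⟨J, hJ, u, hu, hc⟩ := nice_data φ Y hY
  have := isKInjective_GC φ J hJ
  refine good_of_iso φ (asIso (Q.map u)).symm fun X => ?_
  refine map_bij_of_iso (Dphi φ) (Q.objObjPreimageIso X) (Iso.refl _) ?_
  generalize Q.objPreimage X = X'
  let e := (ModuleCat.restrictScalars.{u} φ).mapDerivedCategoryFactors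
  have nat : ∀ {A B : CochainComplex (ModuleCat.{u} S) ℤ} (f : A ⟶ B),
      (Dphi φ).map (Q.map f) ≫ e.hom.app B = e.hom.app A ≫ Q.map ((FC φ).map f) :=
    fun f => e.hom.naturality f
  refine ⟨fun f g hfg => ?_, fun β => ?_⟩
  · obtain ⟨f, rfl⟩ := Q_map_surj _ _ f
    obtain ⟨g, rfl⟩ := Q_map_surj _ _ g
    have h1 : Q.map ((FC φ).map f) = Q.map ((FC φ).map g) := by
      rw [← cancel_epi (e.hom.app X'), ← nat, ← nat, hfg]
    obtain ⟨h⟩ := Q_map_inj _ J ((FC φ).map f ≫ counitC (adjRS φ) J)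
      ((FC φ).map g ≫ counitC (adjRS φ) J) (by rw [Functor.map_comp, Functor.map_comp, h1])
    exact DerivedCategory.Q_map_eq_of_homotopy _ (transpHomotopy (adjRS φ) f g h)
  · obtain ⟨h, hh⟩ := Q_map_surj _ J (e.inv.app X' ≫ β ≫ e.hom.app _ ≫ Q.map (counitC (adjRS φ) J))
    refine ⟨Q.map (transp (adjRS φ) h), ?_⟩
    have h2 : Q.map ((FC φ).map (transp (adjRS φ) h)) ≫ Q.map (counitC (adjRS φ) J) =
        e.inv.app X' ≫ β ≫ e.hom.app _ ≫ Q.map (counitC (adjRS φ) J) := by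
      rw [← hh, ← Functor.map_comp, transp_counitC]
    have h3 : Q.map ((FC φ).map (transp (adjRS φ) h)) = e.inv.app X' ≫ β ≫ e.hom.app _ := by
      rw [← cancel_mono (Q.map (counitC (adjRS φ) J)), h2]
      simp
    rw [← cancel_mono (e.hom.app _), nat, h3]
    exact e.hom_inv_id_app_assoc X' _

lemma good_shift (Y : DerivedCategory (ModuleCat.{u} S)) (h : Good φ Y) (n : ℤ) :
    Good φ (Y⟦n⟧) := by
  intro X
  refine map_bij_of_iso (Dphi φ) (shiftNegShift X n) (Iso.refl _) ?_
  generalize X⟦-n⟧ = X'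
  refine ⟨fun f g hfg => ?_, fun β => ?_⟩
  · obtain ⟨f, rfl⟩ := (shiftFunctor _ n).map_surjective f
    obtain ⟨g, rfl⟩ := (shiftFunctor _ n).map_surjective g
    congr 1
    apply (h _).1
    apply (shiftFunctor _ n).map_injective
    rw [← cancel_epi (((Dphi φ).commShiftIso n).hom.app X'), ← Functor.commShiftIso_hom_naturality,
      ← Functor.commShiftIso_hom_naturality, hfg]
  · obtain ⟨γ, hγ⟩ := (shiftFunctor _ n).map_surjective (((Dphi φ).commShiftIso n).inv.app X' ≫ β ≫
      ((Dphi φ).commShiftIso n).hom.app Y)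
    obtain ⟨α, rfl⟩ := (h _).2 γ
    refine ⟨α⟦n⟧', ?_⟩
    rw [← cancel_mono (((Dphi φ).commShiftIso n).hom.app Y), Functor.commShiftIso_hom_naturality, hγ]
    simp

open Pretriangulated in
lemma good_triangle (T : Triangle (DerivedCategory (ModuleCat.{u} S))) (hT : T ∈ distTriang _)
    (h1 : Good φ T.obj₁) (h2 : Good φ T.obj₂) : Good φ T.obj₃ := by
  have hT' := (Dphi φ).map_distinguished T hT
  have h1' := good_shift φ _ h1 1
  have h2' := good_shift φ _ h2 1
  intro X
  refine ⟨?_, fun β => ?_⟩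
  · refine (injective_iff_map_eq_zero (Functor.mapAddHom (Dphi φ))).2 ?_
    intro f (hf : (Dphi φ).map f = 0)
    have e1 : f ≫ T.mor₃ = 0 := by
      apply (h1' _).1
      rw [Functor.map_comp, hf, zero_comp, Functor.map_zero]
    obtain ⟨g, rfl⟩ := Triangle.coyoneda_exact₃ T hT f e1
    rw [Functor.map_comp] at hf
    obtain ⟨b, hb⟩ := Triangle.coyoneda_exact₂ _ hT' ((Dphi φ).map g) hf
    obtain ⟨a, rfl⟩ := (h1 _).2 b
    have e2 : g = a ≫ T.mor₁ := by
      apply (h2 _).1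
      rw [Functor.map_comp]
      exact hb
    rw [e2, Category.assoc, comp_distTriang_mor_zero₁₂ _ hT, comp_zero]
  · obtain ⟨γ, hγ⟩ := (h1' _).2 (β ≫ (Dphi φ).map T.mor₃)
    have e1 : γ ≫ T.mor₁⟦1⟧' = 0 := by
      apply (h2' _).1
      rw [Functor.map_comp, hγ, Category.assoc, ← Functor.map_comp,
        comp_distTriang_mor_zero₃₁ _ hT, Functor.map_zero, comp_zero, Functor.map_zero]
    obtain ⟨α, rfl⟩ := Triangle.coyoneda_exact₁ T hT γ e1
    obtain ⟨b, hb⟩ := Triangle.coyoneda_exact₃ _ hT' (β - (Dphi φ).map α) (by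
      have h0 : (β - (Dphi φ).map α) ≫ (Dphi φ).map T.mor₃ = 0 := by
        rw [Preadditive.sub_comp, ← Functor.map_comp, hγ, sub_self]
      exact (Category.assoc _ _ _).symm.trans ((congrArg (fun t => t ≫ _) h0).trans zero_comp))
    obtain ⟨a, rfl⟩ := (h2 _).2 b
    refine ⟨α + a ≫ T.mor₂, ?_⟩
    rw [Functor.map_add, Functor.map_comp]
    exact (congrArg (fun t => (Dphi φ).map α + t) hb).symm.trans (by abel)

lemma cond3_to_5
    (h3 : ∀ M : ModuleCat.{u} S, Function.Bijective (etaMap φ M) ∧ ∀ i : ℕ, 1 ≤ i →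
      Subsingleton (Abelian.Ext.{w} (SasR φ) ((ModuleCat.restrictScalars φ).obj M) i)) :
    (Dphi φ).Full ∧ (Dphi φ).Faithful := by
  have hgood : ∀ Y, Good φ Y := fun Y => by
    refine good_of_iso φ (Q.objObjPreimageIso Y) ?_
    generalize Q.objPreimage Y = Y'
    have hP := good_of_nice φ _ (nice_trunc.{w} φ h3 Y')
    have hT := DerivedCategory.triangleOfSES_distinguished (tower_shortExact Y' (truncN Y')
      (truncN_stable Y') (truncN_anti Y') (truncN_bot Y'))
    have h := good_triangle φ _ (Pretriangulated.rot_of_distTriang _ hT) hP hP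
    exact good_of_iso φ (shiftShiftNeg _ (1 : ℤ)) (good_shift φ _ h (-1))
  exact ⟨⟨fun {X Y} f => (hgood Y X).2 f⟩, ⟨fun {X Y} f g h => (hgood Y X).1 h⟩⟩

/-- **Geigle–Lenzing**: characterisations of homological epimorphisms of commutative rings. -/
theorem homological_epimorphism_tfae :
    [ Function.Bijective (mulMap φ) ∧
        ∀ i : ℕ, 1 ≤ i → IsZero (((Tor (ModuleCat.{u} R) i).obj (SasR φ)).obj (SasR φ)),
      ∀ M : ModuleCat.{u} S, Function.Bijective (actionMap φ M) ∧
        ∀ i : ℕ, 1 ≤ i →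
          IsZero (((Tor (ModuleCat.{u} R) i).obj (SasR φ)).obj
            ((ModuleCat.restrictScalars φ).obj M)),
      ∀ M : ModuleCat.{u} S, Function.Bijective (etaMap φ M) ∧
        ∀ i : ℕ, 1 ≤ i →
          Subsingleton (Abelian.Ext.{w} (SasR φ) ((ModuleCat.restrictScalars φ).obj M) i),
      ∀ (M M' : ModuleCat.{u} S) (i : ℕ),
        Function.Bijective (fun e : Abelian.Ext.{w} M M' i => extMap φ e),
      (Dphi φ).Full ∧ (Dphi φ).Faithful ].TFAE := by
  tfae_have 1 → 3 := fun h M => by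
    refine ⟨eta_bijective φ (isEpi_of_mul φ h.1.1) M, fun i hi => ?_⟩
    obtain ⟨n, rfl⟩ : ∃ n, i = n + 1 := ⟨i - 1, by omega⟩
    exact ext_vanish_of_tor.{w} φ h.1.1 h.2 M n
  tfae_have 3 → 5 := fun h => cond3_to_5.{w} φ h
  tfae_have 5 → 4 := fun h => extMap_bijective_of_ff.{w} φ h.1 h.2
  tfae_have 4 → 2 := fun h M => cond4_to_2.{w} φ h M
  tfae_have 2 → 1 := fun h => h (ModuleCat.of S S)
  tfae_finish

end RingHomEpi
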